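/- arXiv:1308.0727 — 8 statements merged into one kernel-verified Lean document; each statement's English description precedes it below -/
import Mathlib

section
/- Let S be a commutative ring. Then S is a Frobenius ring if and only if S is artinian and for every maximal ideal M of S the annihilator ann(M) is a minimal ideal of S. -/
/-- A commutative ring `S` is *Frobenius* if it is artinian and `S/rad(S)` is isomorphic,
as an `S`-module, to the socle of `S` (the sum of all minimal ideals of `S`). -/
def IsFrobeniusRing (S : Type*) [CommRing S] : Prop :=
  IsArtinianRing S ∧
    Nonempty ((S ⧸ Ideal.jacobson (⊥ : Ideal S)) ≃ₗ[S]
      (sSup {J : Ideal S | IsAtom J} : Ideal S))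

/-- A nonzero submodule generated by each of its nonzero elements is an atom. -/
theorem Submodule.isAtom_of_forall_mem_span_singleton {R N : Type*} [Ring R] [AddCommGroup N]
    [Module R N] {I : Submodule R N} (hI : I ≠ ⊥)
    (h : ∀ x ∈ I, x ≠ 0 → ∀ y ∈ I, y ∈ Submodule.span R {x}) : IsAtom I := by
  refine ⟨hI, fun K hK => ?_⟩
  by_contra hne
  obtain ⟨x, hxK, hx0⟩ := Submodule.exists_mem_ne_zero_of_ne_bot hne
  exact hK.not_ge fun y hy =>
    (Submodule.span_singleton_le_iff_mem x K).2 hxK (h x (hK.le hxK) hx0 y hy)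

/-- A nonzero element of an atom generates it. -/
theorem IsAtom.span_singleton_eq {R N : Type*} [Ring R] [AddCommGroup N] [Module R N]
    {I : Submodule R N} (hI : IsAtom I) {x : N} (hx : x ∈ I) (hx0 : x ≠ 0) :
    Submodule.span R {x} = I :=
  (hI.le_iff.1 ((Submodule.span_singleton_le_iff_mem x I).2 hx)).resolve_left
    (by simpa [Submodule.span_singleton_eq_bot] using hx0)

section

variable {S : Type*} [CommRing S]

namespace Ideal

theorem exists_mul_sub_mem_of_notMem {M : Ideal S} (hM : M.IsMaximal) {a : S} (ha : a ∉ M)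
    (b : S) : ∃ t, t * a - b ∈ M := by
  obtain ⟨t, m, hm, h⟩ := hM.exists_inv ha
  refine ⟨b * t, ?_⟩
  have : b * t * a - b = -(b * m) := by linear_combination b * h
  rw [this]
  exact M.neg_mem (M.mul_mem_left b hm)

/-- Every minimal ideal is annihilated by some maximal ideal. -/
theorem exists_isMaximal_le_annihilator_of_isAtom {J : Ideal S} (hJ : IsAtom J) :
    ∃ M : Ideal S, M.IsMaximal ∧ J ≤ Submodule.annihilator M := by
  have := (isSimpleModule_iff_isAtom (m := J)).2 hJ
  refine ⟨Module.annihilator S J, IsSimpleModule.annihilator_isMaximal, fun x hx => ?_⟩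
  rw [Submodule.mem_annihilator]
  intro m hm
  have := Module.mem_annihilator.1 hm ⟨x, hx⟩
  simpa [mul_comm] using congrArg Subtype.val this

/-- The annihilator of a maximal ideal lies in the socle. -/
theorem annihilator_le_sSup_isAtom {M : Ideal S} (hM : M.IsMaximal) :
    Submodule.annihilator M ≤ sSup {J : Ideal S | IsAtom J} := by
  intro x hx
  by_cases hx0 : x = 0
  · simp [hx0]
  refine le_sSup (a := span {x}) ?_ (mem_span_singleton_self x)
  refine Submodule.isAtom_of_forall_mem_span_singleton
    (by simpa [span_singleton_eq_bot] using hx0) fun y hy hy0 z hz => ?_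
  obtain ⟨a, rfl⟩ := mem_span_singleton'.1 hy
  obtain ⟨b, rfl⟩ := mem_span_singleton'.1 hz
  have hxM := Submodule.mem_annihilator.1 hx
  have ha : a ∉ M := fun ha => hy0 (by simpa [mul_comm] using hxM a ha)
  obtain ⟨t, ht⟩ := exists_mul_sub_mem_of_notMem hM ha b
  refine mem_span_singleton'.2 ⟨t, ?_⟩
  have := hxM _ ht
  rw [smul_eq_mul] at this
  linear_combination this

end Ideal

/-- In an artinian ring, each maximal ideal can be separated from all the others. -/
theorem IsArtinianRing.exists_sub_one_mem_and_forall_mem [IsArtinianRing S]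
    (M : MaximalSpectrum S) :
    ∃ e : S, e - 1 ∈ M.asIdeal ∧ ∀ M' : MaximalSpectrum S, M' ≠ M → e ∈ M'.asIdeal := by
  classical
  have := Fintype.ofFinite (MaximalSpectrum S)
  have h : M.asIdeal ⊔ ⨅ M' ∈ Finset.univ.erase M, M'.asIdeal = ⊤ :=
    Ideal.sup_iInf_eq_top fun M' hM' =>
      M.isMaximal.coprime_of_ne M'.isMaximal fun hne =>
        Finset.ne_of_mem_erase hM' (MaximalSpectrum.ext hne.symm)
  obtain ⟨m, hm, e, he, hme⟩ := Submodule.mem_sup.1 ((Ideal.eq_top_iff_one _).1 h)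
  refine ⟨e, ?_, fun M' hM' => ?_⟩
  · rw [← hme, sub_add_cancel_right]
    exact M.asIdeal.neg_mem hm
  · simp only [Submodule.mem_iInf] at he
    exact he M' (Finset.mem_erase.2 ⟨hM', Finset.mem_univ _⟩)

theorem Ideal.mem_jacobson_bot_iff_forall_maximalSpectrum {x : S} :
    x ∈ Ideal.jacobson (⊥ : Ideal S) ↔ ∀ M : MaximalSpectrum S, x ∈ M.asIdeal := by
  simp only [Ideal.jacobson, Submodule.mem_sInf, Set.mem_ofPred_eq, bot_le, true_and]
  exact ⟨fun h M => h _ M.isMaximal, fun h M hM => h ⟨M, hM⟩⟩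

namespace IsFrobeniusRing

theorem isAtom_annihilator (hS : IsFrobeniusRing S) {M : Ideal S} (hM : M.IsMaximal) :
    IsAtom (Submodule.annihilator M) := by
  obtain ⟨_, ⟨f⟩⟩ := hS
  have mem_soc := Ideal.annihilator_le_sSup_isAtom hM
  have lift (x : S) (hx : x ∈ Submodule.annihilator M) :
      ∃ s : S, (f (Ideal.Quotient.mk _ s) : S) = x ∧
        ∀ m ∈ M, m * s ∈ Ideal.jacobson (⊥ : Ideal S) := by
    obtain ⟨s, hs⟩ := Ideal.Quotient.mk_surjective (f.symm ⟨x, mem_soc hx⟩)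
    have hfs : f (Ideal.Quotient.mk _ s) = ⟨x, mem_soc hx⟩ := by rw [hs, f.apply_symm_apply]
    refine ⟨s, by rw [hfs], fun m hm => ?_⟩
    rw [← Ideal.Quotient.eq_zero_iff_mem, ← f.map_eq_zero_iff]
    change f (m • Ideal.Quotient.mk _ s) = 0
    rw [map_smul, hfs]
    ext
    simpa [mul_comm] using Submodule.mem_annihilator.1 hx m hm
  have vanish (s : S) (hs : s ∈ M) (hMs : ∀ m ∈ M, m * s ∈ Ideal.jacobson (⊥ : Ideal S)) :
      Ideal.Quotient.mk (Ideal.jacobson (⊥ : Ideal S)) s = 0 := by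
    rw [Ideal.Quotient.eq_zero_iff_mem, Ideal.mem_jacobson_bot_iff_forall_maximalSpectrum]
    intro M'
    have := Ideal.mem_jacobson_bot_iff_forall_maximalSpectrum.1 (hMs s hs) M'
    exact (M'.isMaximal.isPrime.mem_or_mem this).elim id id
  refine Submodule.isAtom_of_forall_mem_span_singleton (fun hbot => ?_) fun x hx hx0 y hy => ?_
  · obtain ⟨e, he, he'⟩ := IsArtinianRing.exists_sub_one_mem_and_forall_mem ⟨M, hM⟩
    have hmem : (f (Ideal.Quotient.mk _ e) : S) ∈ Submodule.annihilator M := by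
      rw [Submodule.mem_annihilator]
      intro m hm
      have hme : m * e ∈ Ideal.jacobson (⊥ : Ideal S) := by
        rw [Ideal.mem_jacobson_bot_iff_forall_maximalSpectrum]
        intro M'
        by_cases h : M' = ⟨M, hM⟩
        · subst h
          exact M.mul_mem_right e hm
        · exact M'.asIdeal.mul_mem_left m (he' M' h)
      have h0 : m • f (Ideal.Quotient.mk _ e) = 0 := by
        rw [← map_smul, f.map_eq_zero_iff]
        exact Ideal.Quotient.eq_zero_iff_mem.2 hme
      simpa [mul_comm] using congrArg Subtype.val h0
    rw [hbot, Submodule.mem_bot, ZeroMemClass.coe_eq_zero, f.map_eq_zero_iff,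
      Ideal.Quotient.eq_zero_iff_mem, Ideal.mem_jacobson_bot_iff_forall_maximalSpectrum] at hmem
    exact hM.ne_top ((Ideal.eq_top_iff_one M).2 (by
      simpa using M.sub_mem (hmem ⟨M, hM⟩) he))
  · obtain ⟨s, rfl, hs⟩ := lift x hx
    obtain ⟨s', rfl, hs'⟩ := lift y hy
    have hsM : s ∉ M := fun h => hx0 (by rw [vanish s h hs, map_zero, ZeroMemClass.coe_zero])
    obtain ⟨t, ht⟩ := Ideal.exists_mul_sub_mem_of_notMem hM hsM s'
    have h0 := vanish _ ht fun m hm => by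
      have : m * (t * s - s') = t * (m * s) - m * s' := by ring
      rw [this]
      exact sub_mem (Ideal.mul_mem_left _ t (hs m hm)) (hs' m hm)
    rw [map_sub, sub_eq_zero] at h0
    refine Submodule.mem_span_singleton.2 ⟨t, ?_⟩
    rw [← h0, ← Submodule.coe_smul, ← map_smul]
    rfl

theorem of_isAtom_annihilator [IsArtinianRing S]
    (h : ∀ M : Ideal S, M.IsMaximal → IsAtom (Submodule.annihilator M)) :
    IsFrobeniusRing S := by
  classical
  have := Fintype.ofFinite (MaximalSpectrum S)
  have hgen (M : MaximalSpectrum S) :=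
    Submodule.exists_mem_ne_zero_of_ne_bot (h M.asIdeal M.isMaximal).1
  choose x hx hx0 using hgen
  choose e he he' using IsArtinianRing.exists_sub_one_mem_and_forall_mem (S := S)
  have kill (M : MaximalSpectrum S) (m : S) (hm : m ∈ M.asIdeal) : m * x M = 0 := by
    simpa [mul_comm] using Submodule.mem_annihilator.1 (hx M) m hm
  have component (M : MaximalSpectrum S) : e M * ∑ M', x M' = x M := by
    rw [Finset.mul_sum, Finset.sum_eq_single M]
    · linear_combination kill M _ (he M)
    · exact fun M' _ hM' => kill M' _ (he' M M' hM')
    · simp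
  have hker : LinearMap.ker (LinearMap.toSpanSingleton S S (∑ M, x M)) =
      Ideal.jacobson (⊥ : Ideal S) := by
    ext t
    rw [LinearMap.mem_ker, LinearMap.toSpanSingleton_apply, smul_eq_mul,
      Ideal.mem_jacobson_bot_iff_forall_maximalSpectrum]
    refine ⟨fun ht M => ?_, fun ht => ?_⟩
    · by_contra htM
      obtain ⟨u, hu⟩ := Ideal.exists_mul_sub_mem_of_notMem M.isMaximal htM 1
      exact hx0 M (by linear_combination u * e M * ht - u * t * component M - kill M _ hu)
    · rw [Finset.mul_sum]
      exact Finset.sum_eq_zero fun M _ => kill M t (ht M)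
  have hrange : LinearMap.range (LinearMap.toSpanSingleton S S (∑ M, x M)) =
      sSup {J : Ideal S | IsAtom J} := by
    rw [LinearMap.range_toSpanSingleton]
    apply le_antisymm
    · rw [Submodule.span_singleton_le_iff_mem]
      exact sum_mem fun M _ => Ideal.annihilator_le_sSup_isAtom M.isMaximal (hx M)
    · refine sSup_le fun J hJ => ?_
      obtain ⟨M, hM, hJM⟩ := Ideal.exists_isMaximal_le_annihilator_of_isAtom hJ
      refine hJM.trans ?_
      rw [← (h M hM).span_singleton_eq (hx ⟨M, hM⟩) (hx0 ⟨M, hM⟩),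
        Submodule.span_singleton_le_iff_mem]
      exact Submodule.mem_span_singleton.2 ⟨_, component ⟨M, hM⟩⟩
  exact ⟨inferInstance, ⟨(Submodule.quotEquivOfEq _ _ hker.symm).trans
    ((LinearMap.quotKerEquivRange _).trans (LinearEquiv.ofEq _ _ hrange))⟩⟩

end IsFrobeniusRing

end

/-- A commutative ring is Frobenius iff it is artinian and the annihilator of every
maximal ideal is a minimal ideal. -/
theorem frobenius_iff_artinian_ann_maximal_isAtom (S : Type*) [CommRing S] :
    IsFrobeniusRing S ↔
      (IsArtinianRing S ∧
        ∀ M : Ideal S, M.IsMaximal → IsAtom (Submodule.annihilator M)) :=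
  ⟨fun hS => ⟨hS.1, fun _ hM => hS.isAtom_annihilator hM⟩,
    fun ⟨_, h⟩ => IsFrobeniusRing.of_isAtom_annihilator h⟩
end

section
/- Let S be a commutative ring. Then S is a Frobenius local ring if and only if S is artinian and has a unique minimal ideal (i.e., the lattice of ideals of S has exactly one atom). -/
/-- An artinian commutative ring with a unique minimal ideal is local: every non-unit is a
zero divisor, hence annihilates the minimal ideal, and so non-units are closed under addition. -/
theorem IsArtinianRing.isLocalRing_of_existsUnique_isAtom {S : Type*} [CommRing S]
    [IsArtinianRing S] (h : ∃! J : Ideal S, IsAtom J) : IsLocalRing S := by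
  obtain ⟨J, hJ, hJ_unique⟩ := h
  obtain ⟨x, hxJ, hx⟩ := Submodule.exists_mem_ne_zero_of_ne_bot hJ.1
  have : Nontrivial S := ⟨x, 0, hx⟩
  have mul_eq_zero_of_nonunit (a : S) (ha : a ∈ nonunits S) : a * x = 0 := by
    rw [mem_nonunits_iff, IsArtinianRing.isUnit_iff_mem_nonZeroDivisors,
      mem_nonZeroDivisors_iff_right] at ha
    push Not at ha
    obtain ⟨b, hba, hb⟩ := ha
    have h_ker : LinearMap.ker (LinearMap.mulLeft S a) ≠ ⊥ := fun h_bot =>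
      hb ((Submodule.mem_bot S).1 (h_bot ▸ (show b ∈ LinearMap.ker (LinearMap.mulLeft S a) by
        simpa [mul_comm] using hba)))
    obtain ⟨K, hK, hKa⟩ := (eq_bot_or_exists_atom_le _).resolve_left h_ker
    rw [hJ_unique K hK] at hKa
    simpa using hKa hxJ
  refine IsLocalRing.of_nonunits_add fun a b ha hb hab => hx ?_
  rw [← hab.mul_right_eq_zero, add_mul, mul_eq_zero_of_nonunit a ha,
    mul_eq_zero_of_nonunit b hb, add_zero]

/-- A commutative ring is Frobenius and local iff it is artinian and has a unique
minimal ideal (a unique atom in its lattice of ideals). -/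
theorem frobenius_and_local_iff_artinian_unique_atom (S : Type*) [CommRing S] :
    (IsFrobeniusRing S ∧ IsLocalRing S) ↔
      (IsArtinianRing S ∧ ∃! J : Ideal S, IsAtom J) := by
  constructor
  · rintro ⟨⟨hS, ⟨e⟩⟩, hlocal⟩
    refine ⟨hS, ?_⟩
    rw [IsLocalRing.jacobson_eq_maximalIdeal _ bot_ne_top] at e
    have h_simple : IsSimpleModule S (sSup {J : Ideal S | IsAtom J} : Ideal S) :=
      isSimpleModule_iff_quot_maximal.2 ⟨_, inferInstance, ⟨e.symm⟩⟩
    have h_atom := isSimpleModule_iff_isAtom.1 h_simple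
    exact ⟨_, h_atom, fun J hJ => (h_atom.le_iff_eq hJ.1).1 (le_sSup hJ)⟩
  · rintro ⟨hS, hJ⟩
    have hlocal := IsArtinianRing.isLocalRing_of_existsUnique_isAtom hJ
    obtain ⟨J, hJ, hJ_unique⟩ := hJ
    have h_socle : sSup {K : Ideal S | IsAtom K} = J := by
      rw [show {K : Ideal S | IsAtom K} = {J} from
        Set.eq_singleton_iff_unique_mem.2 ⟨hJ, hJ_unique⟩, sSup_singleton]
    refine ⟨⟨hS, ?_⟩, hlocal⟩
    obtain ⟨I, hI, ⟨e⟩⟩ := isSimpleModule_iff_quot_maximal.1 (isSimpleModule_iff_isAtom.2 hJ)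
    rw [h_socle, IsLocalRing.jacobson_eq_maximalIdeal _ bot_ne_top,
      ← IsLocalRing.eq_maximalIdeal hI]
    exact ⟨e.symm⟩
end

section
/- Let S be a commutative artinian ring and let M be a maximal ideal of S. Then ann(M) ≠ 0 and ann(ann(M)) = M. -/
/-- If `S` is a commutative artinian ring and `M` is a maximal ideal of `S`, then
`ann(M) ≠ 0` and `ann(ann(M)) = M`. -/
theorem annihilator_annihilator_of_maximal (S : Type*) [CommRing S] [IsArtinianRing S]
    (M : Ideal S) (hM : M.IsMaximal) :
    Submodule.annihilator M ≠ ⊥ ∧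
      Submodule.annihilator (Submodule.annihilator M) = M := by
  have ann_ne_bot : Submodule.annihilator M ≠ ⊥ := by
    refine (Ideal.bot_lt_annihilator_of_disjoint_nonZeroDivisors ?_).ne'
    refine Set.disjoint_left.mpr fun x hx hx' => hM.ne_top ?_
    exact Ideal.eq_top_of_isUnit_mem _ hx (IsArtinianRing.isUnit_of_mem_nonZeroDivisors hx')
  refine ⟨ann_ne_bot, (hM.eq_of_le ?_ ?_).symm⟩
  · rwa [Ne, Submodule.annihilator_eq_top_iff]
  · rw [Submodule.le_annihilator_iff, smul_eq_mul, Submodule.mul_annihilator]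
end

section
/- Let I be an ideal of R[x] and let f_0, …, f_{n-1} ∈ R[x]. The following three statements are equivalent: (i) for every 0 ≤ i ≤ n-1, I ∩ ⟨π^i⟩ = ⟨π^i f_i, π^{i+1} f_{i+1}, …, π^{n-1} f_{n-1}⟩; (ii) (f_0, …, f_{n-1}) is a canonical sequence of I, i.e., for each 0 ≤ i ≤ n-1, π^i f_i ∈ I and for every f ∈ R[x] with π^i f ∈ I, either f̄ = 0, or f̄_i ≠ 0 and deg f̄_i ≤ deg f̄; (iii) I = ⟨π^0 f_0, π^1 f_1, …, π^{n-1} f_{n-1}⟩ and for each 0 ≤ i ≤ n-2, if f̄_i = 0 then π^i f_i ∈ ⟨π^{i+1} f_{i+1}, …, π^{n-1} f_{n-1}⟩, and if f̄_i ≠ 0 then π^{i+1} f_i ∈ ⟨π^{i+1} f_{i+1}, …, π^{n-1} f_{n-1}⟩. -/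
open Polynomial

/-- The reduction map `R[x] → (R/πR)[x]`. -/
noncomputable def redMod {R : Type*} [CommRing R] (π : R) :
    R[X] →+* (R ⧸ Ideal.span {π})[X] :=
  Polynomial.mapRingHom (Ideal.Quotient.mk (Ideal.span {π}))

/-- `(f 0, …, f (n-1))` is a canonical sequence of the ideal `I` of `R[x]`:
for each `i < n`, `π^i * f i ∈ I`, and for every `g` with `π^i * g ∈ I`, either
`ḡ = 0`, or `f̄ᵢ ≠ 0` and `deg f̄ᵢ ≤ deg ḡ`. -/
def IsCanonicalSequence {R : Type*} [CommRing R] (π : R) (n : ℕ)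
    (I : Ideal R[X]) (f : ℕ → R[X]) : Prop :=
  ∀ i < n, (C π ^ i * f i ∈ I) ∧
    ∀ g : R[X], C π ^ i * g ∈ I →
      redMod π g = 0 ∨ (redMod π (f i) ≠ 0 ∧ (redMod π (f i)).degree ≤ (redMod π g).degree)

theorem redMod_eq_zero_iff {R : Type*} [CommRing R] (π : R) (g : R[X]) :
    redMod π g = 0 ↔ C π ∣ g := by
  rw [C_dvd_iff_dvd_coeff, Polynomial.ext_iff]
  refine forall_congr' fun k => ?_
  simp [redMod, Ideal.Quotient.eq_zero_iff_mem, Ideal.mem_span_singleton]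

theorem redMod_surjective {R : Type*} [CommRing R] (π : R) :
    Function.Surjective (redMod π) :=
  Polynomial.map_surjective _ Ideal.Quotient.mk_surjective

theorem redMod_eq_zero_of_C_pow_mul_mem {R : Type*} [CommRing R] [IsLocalRing R] {π : R} {n : ℕ}
    (hmax : IsLocalRing.maximalIdeal R = Ideal.span {π}) (hnil : π ^ n = 0)
    (hne : π ^ (n - 1) ≠ 0) {i : ℕ} (hi : i < n) {g : R[X]}
    (hg : C π ^ i * g ∈ Ideal.span {C π ^ (i + 1)}) : redMod π g = 0 := by
  rw [redMod_eq_zero_iff, C_dvd_iff_dvd_coeff]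
  intro k
  rw [Ideal.mem_span_singleton, ← C_pow, ← C_pow, C_dvd_iff_dvd_coeff] at hg
  obtain ⟨b, hb⟩ := hg k
  rw [coeff_C_mul] at hb
  rw [← Ideal.mem_span_singleton, ← hmax, IsLocalRing.mem_maximalIdeal, mem_nonunits_iff]
  rintro ⟨u, hu⟩
  rw [← hu] at hb
  have hpow : π ^ i = π ^ (i + 1) * (b * ↑u⁻¹) := by
    rw [← mul_assoc, ← hb, mul_assoc, Units.mul_inv, mul_one]
  apply hne
  have hsplit : n - 1 = (n - 1 - i) + i := by omega
  have hsum : (n - 1 - i) + (i + 1) = n := by omega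
  rw [hsplit, pow_add, hpow, ← mul_assoc, ← pow_add, hsum, hnil, zero_mul]

/-- Division with remainder modulo `π`, lifted to `R[x]`. -/
theorem exists_degree_redMod_sub_mul_lt {R : Type*} [CommRing R] {π : R}
    (hπ : (Ideal.span {π}).IsMaximal) (g : R[X]) {p : R[X]} (hp : redMod π p ≠ 0) :
    ∃ q : R[X], (redMod π (g - q * p)).degree < (redMod π p).degree := by
  let := Ideal.Quotient.field (Ideal.span {π})
  obtain ⟨q, hq⟩ := redMod_surjective π (redMod π g / redMod π p)
  refine ⟨q, ?_⟩
  have hmod : redMod π (g - q * p) = redMod π g % redMod π p := by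
    rw [map_sub, map_mul, hq, EuclideanDomain.mod_eq_sub_mul_div, mul_comm]
  rw [hmod]
  exact EuclideanDomain.mod_lt _ hp

section PowMulSpan

variable {R : Type*} [CommRing R] {π : R} {n : ℕ} {f : ℕ → R[X]}

theorem mem_span_image_Ico_iff {i : ℕ} (hi : i < n) {x : R[X]} :
    x ∈ Ideal.span ((fun j => C π ^ j * f j) '' Set.Ico i n) ↔
      ∃ h, ∃ s ∈ Ideal.span ((fun j => C π ^ j * f j) '' Set.Ico (i + 1) n),
        x = h * (C π ^ i * f i) + s := by
  have hIco : Set.Ico i n = insert i (Set.Ico (i + 1) n) := by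
    ext j
    simp only [Set.mem_Ico, Set.mem_insert_iff]
    omega
  rw [hIco, Set.image_insert_eq, Ideal.mem_span_insert]

theorem span_image_Ico_le_span_pow (i : ℕ) :
    Ideal.span ((fun j => C π ^ j * f j) '' Set.Ico i n) ≤ Ideal.span {C π ^ i} := by
  rw [Ideal.span_le]
  rintro _ ⟨j, hj, rfl⟩
  exact Ideal.mem_span_singleton.2 ((pow_dvd_pow _ hj.1).mul_right _)

theorem C_pow_mul_mem_span_image_Ico {i j : ℕ} (hij : i ≤ j) (hj : j < n) :
    C π ^ j * f j ∈ Ideal.span ((fun j => C π ^ j * f j) '' Set.Ico i n) :=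
  Ideal.subset_span ⟨j, ⟨hij, hj⟩, rfl⟩

theorem IsCanonicalSequence.C_pow_mul_mem_span {I : Ideal R[X]}
    (hf : IsCanonicalSequence π n I f) (hπ : (Ideal.span {π}).IsMaximal) (hnil : π ^ n = 0)
    {i : ℕ} (hi : i ≤ n) {g : R[X]} (hg : C π ^ i * g ∈ I) :
    C π ^ i * g ∈ Ideal.span ((fun j => C π ^ j * f j) '' Set.Ico i n) := by
  induction hi using Nat.decreasingInduction generalizing g with
  | self => simp only [← C_pow, hnil, C_0, zero_mul, zero_mem]
  | of_succ i hi ih =>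
    rw [mem_span_image_Ico_iff hi]
    obtain ⟨q, hq⟩ : ∃ q, redMod π (g - q * f i) = 0 := by
      rcases (hf i hi).2 g hg with h0 | ⟨hfi, -⟩
      · exact ⟨0, by simpa using h0⟩
      · obtain ⟨q, hq⟩ := exists_degree_redMod_sub_mul_lt hπ g hfi
        refine ⟨q, ((hf i hi).2 (g - q * f i) ?_).resolve_right fun h => h.2.not_gt hq⟩
        rw [mul_sub, mul_left_comm]
        exact I.sub_mem hg (I.mul_mem_left _ (hf i hi).1)
    obtain ⟨g', hg'⟩ := (redMod_eq_zero_iff π _).1 hq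
    have hrem : C π ^ (i + 1) * g' = C π ^ i * g - q * (C π ^ i * f i) := by
      rw [pow_succ, mul_assoc, ← hg']
      ring
    refine ⟨q, C π ^ (i + 1) * g', ih ?_, by rw [hrem]; ring⟩
    rw [hrem]
    exact I.sub_mem hg (I.mul_mem_left _ (hf i hi).1)

end PowMulSpan

/-- Proposition 3.1: characterizations of canonical sequences. -/
theorem canonicalSequence_tfae {R : Type*} [CommRing R] [IsLocalRing R]
    (π : R) (n : ℕ) (hn : 1 ≤ n)
    (hmax : IsLocalRing.maximalIdeal R = Ideal.span {π})
    (hnil : π ^ n = 0) (hne : π ^ (n - 1) ≠ 0)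
    (I : Ideal R[X]) (f : ℕ → R[X]) :
    List.TFAE
      [ ∀ i < n, I ⊓ Ideal.span {C π ^ i} =
          Ideal.span ((fun j => C π ^ j * f j) '' Set.Ico i n),
        IsCanonicalSequence π n I f,
        I = Ideal.span ((fun j => C π ^ j * f j) '' Set.Ico 0 n) ∧
          ∀ i, i + 1 < n →
            (redMod π (f i) = 0 →
              C π ^ i * f i ∈
                Ideal.span ((fun j => C π ^ j * f j) '' Set.Ico (i + 1) n)) ∧
            (redMod π (f i) ≠ 0 →
              C π ^ (i + 1) * f i ∈
                Ideal.span ((fun j => C π ^ j * f j) '' Set.Ico (i + 1) n)) ] := by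
  have hπ : (Ideal.span {π}).IsMaximal := hmax ▸ IsLocalRing.maximalIdeal.isMaximal R
  have hdom : IsDomain (R ⧸ Ideal.span {π}) := Ideal.Quotient.isDomain _
  tfae_have 1 → 2 := by
    intro h i hi
    have hle := (h i hi).ge
    refine ⟨(hle (C_pow_mul_mem_span_image_Ico le_rfl hi)).1, fun g hg => ?_⟩
    have hmem : C π ^ i * g ∈ I ⊓ Ideal.span {C π ^ i} :=
      ⟨hg, Ideal.mul_mem_right _ _ (Ideal.mem_span_singleton_self _)⟩
    rw [h i hi, mem_span_image_Ico_iff hi] at hmem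
    obtain ⟨q, s, hs, hgs⟩ := hmem
    have hred : redMod π (g - q * f i) = 0 := by
      apply redMod_eq_zero_of_C_pow_mul_mem hmax hnil hne hi
      have hsub : C π ^ i * (g - q * f i) = s := by
        rw [mul_sub, hgs]
        ring
      rw [hsub]
      exact span_image_Ico_le_span_pow _ hs
    rw [map_sub, sub_eq_zero, map_mul] at hred
    refine or_iff_not_imp_left.2 fun hg0 => ?_
    rw [hred] at hg0 ⊢
    exact ⟨right_ne_zero_of_mul hg0, by
      rw [mul_comm]
      exact degree_le_mul_left _ (left_ne_zero_of_mul hg0)⟩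
  tfae_have 2 → 1 := by
    intro h i hi
    apply le_antisymm
    · rintro g ⟨hgI, hg⟩
      obtain ⟨g, rfl⟩ := Ideal.mem_span_singleton.1 hg
      exact h.C_pow_mul_mem_span hπ hnil hi.le hgI
    · refine le_inf (Ideal.span_le.2 ?_) (span_image_Ico_le_span_pow i)
      rintro _ ⟨j, hj, rfl⟩
      exact (h j hj.2).1
  tfae_have 1 → 3 := by
    intro h
    refine ⟨by simpa using h 0 hn, fun i hi => ?_⟩
    have hfi : C π ^ i * f i ∈ I :=
      ((h i (by omega)).ge (C_pow_mul_mem_span_image_Ico le_rfl (by omega))).1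
    rw [← h (i + 1) hi]
    refine ⟨fun h0 => ⟨hfi, ?_⟩, fun _ => ⟨?_, ?_⟩⟩
    · obtain ⟨g, hg⟩ := (redMod_eq_zero_iff π _).1 h0
      rw [hg, ← mul_assoc, ← pow_succ]
      exact Ideal.mul_mem_right _ _ (Ideal.mem_span_singleton_self _)
    · rw [pow_succ', mul_assoc]
      exact I.mul_mem_left _ hfi
    · exact Ideal.mul_mem_right _ _ (Ideal.mem_span_singleton_self _)
  tfae_have 3 → 1 := by
    rintro ⟨hI, h⟩ i hi
    induction i with
    | zero => simpa using hI
    | succ i ih =>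
      have hin : i < n := by omega
      apply le_antisymm
      · rintro g ⟨hgI, hg⟩
        have hmem : g ∈ I ⊓ Ideal.span {C π ^ i} :=
          ⟨hgI, Ideal.span_singleton_le_span_singleton.2 (pow_dvd_pow _ i.le_succ) hg⟩
        rw [ih hin, mem_span_image_Ico_iff hin] at hmem
        obtain ⟨q, s, hs, rfl⟩ := hmem
        refine Ideal.add_mem _ ?_ hs
        have hred : redMod π (q * f i) = 0 := by
          apply redMod_eq_zero_of_C_pow_mul_mem hmax hnil hne hin
          rw [mul_left_comm]
          exact (Ideal.add_mem_iff_left _ (span_image_Ico_le_span_pow _ hs)).1 hg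
        by_cases h0 : redMod π (f i) = 0
        · exact Ideal.mul_mem_left _ _ ((h i hi).1 h0)
        · rw [map_mul] at hred
          obtain ⟨q', rfl⟩ :=
            (redMod_eq_zero_iff π q).1 ((mul_eq_zero.1 hred).resolve_right h0)
          have hcomm : C π * q' * (C π ^ i * f i) = q' * (C π ^ (i + 1) * f i) := by ring
          rw [hcomm]
          exact Ideal.mul_mem_left _ _ ((h i hi).2 h0)
      · refine le_inf ?_ (span_image_Ico_le_span_pow _)
        rw [hI]
        exact Ideal.span_mono (Set.image_mono (Set.Ico_subset_Ico_left (Nat.zero_le _)))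
  tfae_finish
end

section
/- Let I be an ideal of R[x] with canonical sequence (f_0, …, f_{n-1}) such that for each 0 ≤ i ≤ n-1, either f_i = 0 or the leading coefficient of f_i is a unit of R (equivalently deg f_i = deg f̄_i). Then {π^0 f_0, …, π^{n-1} f_{n-1}} is a strong Gröbner basis of I: for every nonzero f ∈ I there exists i ∈ {0, …, n-1} with π^i f_i ≠ 0 such that the leading term of π^i f_i divides the leading term of f, i.e., deg(π^i f_i) ≤ deg f and the leading coefficient of π^i f_i divides the leading coefficient of f in R. -/
open Polynomial

/-- A polynomial with unit leading coefficient keeps its degree modulo a proper principal ideal. -/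
theorem degree_redMod_of_isUnit_leadingCoeff {R : Type*} [CommRing R] {π : R}
    (hπ : ¬IsUnit π) {f : R[X]} (hf : IsUnit f.leadingCoeff) :
    (redMod π f).degree = f.degree := by
  refine degree_map_eq_of_leadingCoeff_ne_zero _ fun h => hπ ?_
  rw [Ideal.Quotient.eq_zero_iff_mem, Ideal.mem_span_singleton] at h
  exact isUnit_of_dvd_unit h hf

/-- Coefficients killed by a nonzero power of `π` vanish modulo `π`, so dividing by that power
does not raise the degree of the reduction. -/
theorem degree_redMod_le_degree_C_pow_mul {R : Type*} [CommRing R] [IsLocalRing R] {π : R}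
    (hmax : IsLocalRing.maximalIdeal R = Ideal.span {π}) {i : ℕ} (hi : π ^ i ≠ 0) (h : R[X]) :
    (redMod π h).degree ≤ (C π ^ i * h).degree := by
  refine (degree_le_iff_coeff_zero _ _).2 fun k hk => ?_
  have hzero : π ^ i * h.coeff k = 0 := by
    rw [← coeff_C_mul, C_pow]
    exact coeff_eq_zero_of_degree_lt hk
  have hmem : h.coeff k ∈ Ideal.span {π} := by
    rw [← hmax, IsLocalRing.mem_maximalIdeal]
    exact fun hu => hi (hu.mul_left_eq_zero.1 hzero)
  simpa [redMod, Ideal.Quotient.eq_zero_iff_mem] using hmem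

/-- If `π` is nilpotent, a nonzero polynomial is a power of `π` times a polynomial that does not
vanish modulo `π`. -/
theorem exists_eq_C_pow_mul_redMod_ne_zero {R : Type*} [CommRing R] {π : R} {n : ℕ}
    (hnil : π ^ n = 0) {g : R[X]} (hg : g ≠ 0) :
    ∃ i < n, ∃ h : R[X], g = C π ^ i * h ∧ redMod π h ≠ 0 := by
  classical
  have hn : ¬C π ^ n ∣ g := by simpa [← C_pow, hnil] using hg
  have hex : ∃ m, ¬C π ^ m ∣ g := ⟨n, hn⟩
  obtain ⟨i, hi⟩ : ∃ i, Nat.find hex = i + 1 :=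
    Nat.exists_eq_succ_of_ne_zero fun h0 => Nat.find_spec hex (by simp [h0])
  have hin : i < n := by
    have := Nat.find_min' hex hn
    omega
  obtain ⟨h, rfl⟩ := not_not.1 (Nat.find_min hex (by omega : i < Nat.find hex))
  refine ⟨i, hin, h, rfl, fun h0 => Nat.find_spec hex ?_⟩
  rw [hi, pow_succ]
  exact mul_dvd_mul_left _ ((redMod_eq_zero_iff π h).1 h0)

/-- Proposition 3.4: if `(f 0, …, f (n-1))` is a canonical sequence of `I` each of whose
entries is `0` or has unit leading coefficient, then `{π^0 f 0, …, π^(n-1) f (n-1)}` is a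
strong Gröbner basis of `I`. -/
theorem strong_groebner_of_canonicalSequence {R : Type*} [CommRing R] [IsLocalRing R]
    (π : R) (n : ℕ) (hn : 1 ≤ n)
    (hmax : IsLocalRing.maximalIdeal R = Ideal.span {π})
    (hnil : π ^ n = 0) (hne : π ^ (n - 1) ≠ 0)
    (I : Ideal R[X]) (f : ℕ → R[X])
    (hcan : IsCanonicalSequence π n I f)
    (hlc : ∀ i < n, f i = 0 ∨ IsUnit (f i).leadingCoeff) :
    ∀ g ∈ I, g ≠ 0 → ∃ i < n, C π ^ i * f i ≠ 0 ∧
      (C π ^ i * f i).degree ≤ g.degree ∧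
      (C π ^ i * f i).leadingCoeff ∣ g.leadingCoeff := by
  intro g hgI hg
  obtain ⟨i, hin, h, rfl, hh⟩ := exists_eq_C_pow_mul_redMod_ne_zero hnil hg
  have hi : π ^ i ≠ 0 := fun h0 => hne (pow_eq_zero_of_le (by omega) h0)
  have hπ : ¬IsUnit π := fun hu => not_isUnit_zero (hnil ▸ hu.pow n)
  obtain ⟨hfi, hdeg⟩ := ((hcan i hin).2 h hgI).resolve_left hh
  have hu : IsUnit (f i).leadingCoeff :=
    (hlc i hin).resolve_left fun h0 => hfi (by rw [h0, map_zero])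
  have hlead : π ^ i * (f i).leadingCoeff ≠ 0 := fun h0 => hi (hu.mul_left_eq_zero.1 h0)
  have hlc_mul : (C π ^ i * f i).leadingCoeff = π ^ i * (f i).leadingCoeff := by
    rw [← C_pow, leadingCoeff_mul' (by rwa [leadingCoeff_C]), leadingCoeff_C]
  refine ⟨i, hin, ?_, ?_, ?_⟩
  · rwa [← leadingCoeff_ne_zero, hlc_mul]
  · calc
      (C π ^ i * f i).degree ≤ (f i).degree := by
        rw [← C_pow, ← smul_eq_C_mul]
        exact degree_smul_le _ _
      _ = (redMod π (f i)).degree := (degree_redMod_of_isUnit_leadingCoeff hπ hu).symm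
      _ ≤ (redMod π h).degree := hdeg
      _ ≤ (C π ^ i * h).degree := degree_redMod_le_degree_C_pow_mul hmax hi h
  · rw [hlc_mul, hu.mul_right_dvd, leadingCoeff, ← C_pow, coeff_C_mul]
    exact dvd_mul_right _ _
end

section
/- Let I be a proper ideal of R[x] with invariant sequence (α_0, …, α_{n-1}). An ideal M of R[x] is a maximal ideal of R[x] containing I if and only if M = ⟨r, π⟩ for some r ∈ R[x] such that r̄ is irreducible in F[x] and r̄ divides α_0. Consequently, the maximal ideals of R[x]/I are precisely the ideals ⟨r, π⟩/I with r̄ an irreducible factor of α_0. -/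
open Polynomial

/-- The kernel of the reduction map is generated by the constant `π`. -/
theorem ker_redMod {R : Type*} [CommRing R] (π : R) :
    RingHom.ker (redMod π) = Ideal.span {C π} := by
  rw [redMod, Polynomial.ker_mapRingHom, Ideal.mk_ker, Ideal.map_span, Set.image_singleton]

/-- `⟨r, π⟩` is the preimage of `⟨r̄⟩` under reduction. -/
theorem comap_redMod_span_singleton {R : Type*} [CommRing R] (π : R) (r : R[X]) :
    Ideal.comap (redMod π) (Ideal.span {redMod π r}) = Ideal.span {r, C π} := by
  rw [← Set.image_singleton, ← Ideal.map_span,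
    Ideal.comap_map_of_surjective' _ (redMod_surjective π), ker_redMod, ← Ideal.span_union,
    Set.singleton_union]

/-- If the image of `a ∈ I` has minimal degree among the nonzero images of elements of `I`,
then it divides the image of every element of `I`. -/
theorem map_dvd_of_degree_minimal {A K : Type*} [CommRing A] [Field K] {φ : A →+* K[X]}
    (hφ : Function.Surjective φ) {I : Ideal A} {a : A} (ha : a ∈ I)
    (hmin : ∀ g ∈ I, φ g = 0 ∨ (φ a ≠ 0 ∧ (φ a).degree ≤ (φ g).degree))
    {g : A} (hg : g ∈ I) : φ a ∣ φ g := by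
  by_cases h0 : φ a = 0
  · rcases hmin g hg with h | h
    · simp [h]
    · exact absurd h0 h.1
  obtain ⟨q, hq⟩ := hφ (φ g / φ a)
  have hmod : φ (g - a * q) = φ g % φ a := by
    rw [map_sub, map_mul, hq, sub_eq_iff_eq_add, EuclideanDomain.mod_add_div]
  rcases hmin _ (I.sub_mem hg (I.mul_mem_right q ha)) with h | h
  · exact EuclideanDomain.mod_eq_zero.mp (hmod ▸ h)
  · rw [hmod] at h
    exact absurd (Polynomial.degree_mod_lt (φ g) h0) (not_lt.mpr h.2)

/-- For a surjection `φ` onto a polynomial ring over a field, the maximal ideals containing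
`ker φ` are the preimages of the ideals generated by irreducible polynomials. -/
theorem isMaximal_and_ker_le_iff {A K : Type*} [CommRing A] [Field K] {φ : A →+* K[X]}
    (hφ : Function.Surjective φ) (M : Ideal A) :
    (M.IsMaximal ∧ RingHom.ker φ ≤ M) ↔
      ∃ r : A, Irreducible (φ r) ∧ M = Ideal.comap φ (Ideal.span {φ r}) := by
  constructor
  · rintro ⟨hM, hker⟩
    have hcomap : Ideal.comap φ (Ideal.map φ M) = M := by
      rw [Ideal.comap_map_of_surjective' _ hφ, sup_eq_left.mpr hker]
    have hmap : (Ideal.map φ M).IsMaximal :=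
      (Ideal.map_eq_top_or_isMaximal_of_surjective φ hφ hM).resolve_left fun h =>
        hM.ne_top (by rw [← hcomap, h, Ideal.comap_top])
    obtain ⟨p, hp⟩ := (IsPrincipalIdealRing.principal (Ideal.map φ M)).principal
    obtain ⟨r, rfl⟩ := hφ p
    have hp' : Ideal.map φ M = Ideal.span {φ r} := hp
    have h0 : φ r ≠ 0 := by
      intro h0
      rw [hp', h0, Ideal.span_singleton_eq_bot.mpr rfl] at hmap
      exact Polynomial.not_isField K (Ring.isField_iff_isSimpleOrder_ideal.mpr
        (isSimpleOrder_iff_isCoatom_bot.mpr hmap.out))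
    refine ⟨r, ?_, by rw [← hp', hcomap]⟩
    rw [hp'] at hmap
    exact ((Ideal.span_singleton_prime h0).mp hmap.isPrime).irreducible
  · rintro ⟨r, hr, rfl⟩
    have := PrincipalIdealRing.isMaximal_of_irreducible hr
    exact ⟨Ideal.comap_isMaximal_of_surjective φ hφ, Ideal.ker_le_comap φ⟩

/-- If the maximal ideals of `A` containing `I` are described by a predicate `P`, then the maximal
ideals of `A ⧸ I` are the images of the ideals satisfying `P`. -/
theorem isMaximal_quotient_iff {A : Type*} [CommRing A] {I : Ideal A} {P : Ideal A → Prop}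
    (h : ∀ M : Ideal A, (M.IsMaximal ∧ I ≤ M) ↔ P M) (M' : Ideal (A ⧸ I)) :
    M'.IsMaximal ↔ ∃ M, P M ∧ M' = Ideal.map (Ideal.Quotient.mk I) M := by
  have hs : Function.Surjective (Ideal.Quotient.mk I) := Ideal.Quotient.mk_surjective
  constructor
  · intro hM'
    refine ⟨Ideal.comap (Ideal.Quotient.mk I) M', (h _).mp
      ⟨Ideal.comap_isMaximal_of_surjective _ hs, ?_⟩, (Ideal.map_comap_of_surjective _ hs M').symm⟩
    simpa only [Ideal.mk_ker] using Ideal.ker_le_comap (K := M') (Ideal.Quotient.mk I)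
  · rintro ⟨M, hPM, rfl⟩
    obtain ⟨hM, hIM⟩ := (h M).mpr hPM
    refine (Ideal.map_eq_top_or_isMaximal_of_surjective _ hs hM).resolve_left fun htop => ?_
    apply hM.ne_top
    rw [← Ideal.comap_map_mk hIM, htop, Ideal.comap_top]

/-- Proposition 4.1: for a proper ideal `I` of `R[x]` with invariant sequence
`(α₀, …, α_{n-1})` (here `α₀ = f̄₀` for a canonical sequence `f` of `I`), the maximal
ideals of `R[x]` containing `I` are precisely the ideals `⟨r, π⟩` with `r̄` an irreducible
factor of `α₀`; consequently the maximal ideals of `R[x]/I` are precisely the ideals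
`⟨r, π⟩/I` with `r̄` an irreducible factor of `α₀`. -/
theorem maximalIdeals_of_quotient {R : Type*} [CommRing R] [IsLocalRing R]
    (π : R) (n : ℕ) (hn : 1 ≤ n)
    (hmax : IsLocalRing.maximalIdeal R = Ideal.span {π})
    (hnil : π ^ n = 0) (hne : π ^ (n - 1) ≠ 0)
    (I : Ideal R[X]) (hI : I ≠ ⊤) (f : ℕ → R[X])
    (hcan : IsCanonicalSequence π n I f) :
    (∀ M : Ideal R[X], (M.IsMaximal ∧ I ≤ M) ↔
      (∃ r : R[X], Irreducible (redMod π r) ∧ redMod π r ∣ redMod π (f 0) ∧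
        M = Ideal.span {r, C π})) ∧
    (∀ M' : Ideal (R[X] ⧸ I), M'.IsMaximal ↔
      (∃ r : R[X], Irreducible (redMod π r) ∧ redMod π r ∣ redMod π (f 0) ∧
        M' = Ideal.map (Ideal.Quotient.mk I) (Ideal.span {r, C π}))) := by
  have : (Ideal.span {π}).IsMaximal := hmax ▸ IsLocalRing.maximalIdeal.isMaximal R
  let : Field (R ⧸ Ideal.span {π}) := Ideal.Quotient.field _
  have hφ := redMod_surjective π
  obtain ⟨hf, hmin⟩ := hcan 0 hn
  simp only [pow_zero, one_mul] at hf hmin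
  have key : ∀ M : Ideal R[X], (M.IsMaximal ∧ I ≤ M) ↔
      ∃ r : R[X], Irreducible (redMod π r) ∧ redMod π r ∣ redMod π (f 0) ∧
        M = Ideal.span {r, C π} := by
    intro M
    constructor
    · rintro ⟨hM, hIM⟩
      have hker : RingHom.ker (redMod π) ≤ M := by
        rw [ker_redMod, Ideal.span_singleton_le_iff_mem]
        refine hM.isPrime.mem_of_pow_mem n ?_
        rw [← C_pow, hnil, C_0]
        exact M.zero_mem
      obtain ⟨r, hr, rfl⟩ := (isMaximal_and_ker_le_iff hφ M).mp ⟨hM, hker⟩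
      exact ⟨r, hr, Ideal.mem_span_singleton.mp (hIM hf), comap_redMod_span_singleton π r⟩
    · rintro ⟨r, hr, hdvd, rfl⟩
      rw [← comap_redMod_span_singleton]
      exact ⟨((isMaximal_and_ker_le_iff hφ _).mpr ⟨r, hr, rfl⟩).1, fun g hg =>
        Ideal.mem_span_singleton.mpr (hdvd.trans (map_dvd_of_degree_minimal hφ hf hmin hg))⟩
  refine ⟨key, fun M' => (isMaximal_quotient_iff key M').trans ⟨?_, ?_⟩⟩
  · rintro ⟨_, ⟨r, hr, hdvd, rfl⟩, hM'⟩
    exact ⟨r, hr, hdvd, hM'⟩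
  · rintro ⟨r, hr, hdvd, hM'⟩
    exact ⟨_, ⟨r, hr, hdvd, rfl⟩, hM'⟩
end

section
/- Let I and J be ideals of R[x] with canonical sequences (f_0, …, f_{n-1}) and (g_0, …, g_{n-1}) respectively. If I ⊆ J and f̄_i is an associate of ḡ_i in F[x] for every 0 ≤ i ≤ n-1 (i.e., I and J have the same invariant sequence), then I = J. -/
open Polynomial

theorem exists_eq_C_mul_of_redMod_eq_zero {R : Type*} [CommRing R] {π : R} {h : R[X]}
    (hh : redMod π h = 0) : ∃ k : R[X], h = C π * k := by
  refine C_dvd_iff_dvd_coeff _ _ |>.2 fun i => ?_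
  rw [← Ideal.mem_span_singleton, ← Ideal.Quotient.eq_zero_iff_mem]
  simpa [redMod] using congrArg (fun p => p.coeff i) hh

/-- Division with remainder by `f` modulo a generator `π` of a maximal ideal. -/
theorem exists_redMod_sub_mul_eq_zero_or_degree_lt {R : Type*} [CommRing R] {π : R}
    (hπ : (Ideal.span {π}).IsMaximal) (f h : R[X]) :
    ∃ q : R[X], redMod π f = 0 ∨
      (redMod π (h - q * f)).degree < (redMod π f).degree := by
  let _ : Field (R ⧸ Ideal.span {π}) := Ideal.Quotient.field _
  obtain ⟨q, hq⟩ := redMod_surjective π (redMod π h / redMod π f)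
  refine ⟨q, or_iff_not_imp_left.2 fun hf => ?_⟩
  have hr : redMod π (h - q * f) = redMod π h % redMod π f := by
    rw [map_sub, map_mul, hq, EuclideanDomain.mod_eq_sub_mul_div, mul_comm]
  rw [hr]
  exact EuclideanDomain.mod_lt _ hf

/-- Lemma 4.2: if `I ⊆ J` and `I`, `J` have the same invariant sequence, then `I = J`. -/
theorem eq_of_le_of_same_invariant_sequence {R : Type*} [CommRing R] [IsLocalRing R]
    (π : R) (n : ℕ) (hn : 1 ≤ n)
    (hmax : IsLocalRing.maximalIdeal R = Ideal.span {π})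
    (hnil : π ^ n = 0) (hne : π ^ (n - 1) ≠ 0)
    (I J : Ideal R[X]) (f g : ℕ → R[X])
    (hf : IsCanonicalSequence π n I f) (hg : IsCanonicalSequence π n J g)
    (hIJ : I ≤ J)
    (hassoc : ∀ i < n, Associated (redMod π (f i)) (redMod π (g i))) :
    I = J := by
  have hmaxl : (Ideal.span {π}).IsMaximal := hmax ▸ inferInstance
  suffices key : ∀ k i : ℕ, i + k = n → ∀ h : R[X], C π ^ i * h ∈ J → C π ^ i * h ∈ I by
    refine le_antisymm hIJ fun h hh => ?_
    simpa using key n 0 (zero_add n) h (by simpa using hh)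
  intro k
  induction k with
  | zero =>
    rintro i rfl h -
    rw [← C_pow, ← add_zero i, hnil]
    simp
  | succ k ih =>
    intro i hik h hh
    have hi : i < n := by lia
    obtain ⟨hfI, -⟩ := hf i hi
    obtain ⟨-, hgJ⟩ := hg i hi
    have hzero := (hassoc i hi).eq_zero_iff
    obtain ⟨q, hq⟩ := exists_redMod_sub_mul_eq_zero_or_degree_lt hmaxl (f i) h
    have hqI : C π ^ i * (q * f i) ∈ I := by
      rw [mul_left_comm]
      exact I.mul_mem_left q hfI
    have hrJ : C π ^ i * (h - q * f i) ∈ J := by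
      rw [mul_sub]
      exact J.sub_mem hh (hIJ hqI)
    have hr : redMod π (h - q * f i) = 0 := by
      refine (hgJ _ hrJ).resolve_right fun ⟨hg0, hle⟩ => ?_
      have hlt := hq.resolve_left fun hf0 => hg0 (hzero.1 hf0)
      let _ : Field (R ⧸ Ideal.span {π}) := Ideal.Quotient.field _
      exact (hlt.trans_le
        (Polynomial.degree_le_of_dvd (hassoc i hi).dvd hg0)).not_ge hle
    obtain ⟨r, hr⟩ := exists_eq_C_mul_of_redMod_eq_zero hr
    rw [hr, ← mul_assoc, ← pow_succ] at hrJ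
    have hrI := ih (i + 1) (by lia) r hrJ
    rw [pow_succ, mul_assoc, ← hr, mul_sub] at hrI
    simpa using I.add_mem hrI hqI
end

section
/- Let I be a proper ideal of R[x] with invariant sequence (α_0, …, α_{n-1}). Then R[x]/I is a local ring if and only if there exist an irreducible polynomial α ∈ F[x] and integers e_0 ≥ e_1 ≥ ⋯ ≥ e_{n-1} ≥ 0 with e_0 > 0 such that α_j is an associate of α^{e_j} for every 0 ≤ j ≤ n-1. -/
open Polynomial

theorem C_dvd_of_redMod_eq_zero {R : Type*} [CommRing R] {π : R} {g : R[X]}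
    (h : redMod π g = 0) : C π ∣ g := by
  rw [C_dvd_iff_dvd_coeff]
  intro i
  have hi := congrArg (fun p => p.coeff i) h
  simpa [redMod, Ideal.Quotient.eq_zero_iff_mem, Ideal.mem_span_singleton] using hi

theorem redMod_C_self {R : Type*} [CommRing R] (π : R) : redMod π (C π) = 0 := by
  simp [redMod]

/-- The `i`-th entry of the invariant sequence generates the `i`-th colon ideal modulo `π`. -/
theorem IsCanonicalSequence.redMod_dvd {R : Type*} [CommRing R] {π : R} {n : ℕ}
    {I : Ideal R[X]} {f : ℕ → R[X]} (hcan : IsCanonicalSequence π n I f)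
    (hmax : (Ideal.span {π}).IsMaximal) {i : ℕ} (hi : i < n) {g : R[X]}
    (hg : C π ^ i * g ∈ I) : redMod π (f i) ∣ redMod π g := by
  let : Field (R ⧸ Ideal.span {π}) := Ideal.Quotient.field _
  obtain ⟨hf, hmin⟩ := hcan i hi
  by_cases h0 : redMod π (f i) = 0
  · rcases hmin g hg with h | h
    · rw [h]
      exact dvd_zero _
    · exact absurd h0 h.1
  obtain ⟨q, hq⟩ := redMod_surjective π (redMod π g / redMod π (f i))
  have hmod : redMod π (g - q * f i) = redMod π g % redMod π (f i) := by
    rw [map_sub, map_mul, hq, EuclideanDomain.mod_eq_sub_mul_div, mul_comm]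
  have hmem : C π ^ i * (g - q * f i) ∈ I := by
    have : C π ^ i * (g - q * f i) = C π ^ i * g - q * (C π ^ i * f i) := by ring
    rw [this]
    exact I.sub_mem hg (I.mul_mem_left _ hf)
  rcases hmin _ hmem with h | ⟨-, h⟩
  · exact EuclideanDomain.mod_eq_zero.mp (hmod ▸ h)
  · rw [hmod] at h
    exact absurd (EuclideanDomain.mod_lt (redMod π g) h0) (not_lt.mpr h)

/-- A polynomial reducing to `1` modulo the nilpotent `π` is a unit in every quotient. -/
theorem Ideal.isUnit_mk_of_redMod_eq_one {R : Type*} [CommRing R] {π : R} {n : ℕ}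
    (hnil : π ^ n = 0) (I : Ideal R[X]) {g : R[X]} (h : redMod π g = 1) :
    IsUnit (Ideal.Quotient.mk I g) := by
  refine IsUnit.map _ ?_
  obtain ⟨c, hc⟩ := C_dvd_of_redMod_eq_zero (π := π) (g := g - 1) (by simp [h])
  have hn : IsNilpotent (g - 1) := ⟨n, by rw [hc, mul_pow, ← C_pow, hnil, C_0, zero_mul]⟩
  simpa using hn.isUnit_add_one

theorem exists_associated_pow_of_isLocalRing_quotient {F : Type*} [Field F] {p : F[X]}
    (hp : ¬ IsUnit p) [IsLocalRing (F[X] ⧸ Ideal.span {p})] :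
    ∃ (α : F[X]) (e : ℕ), Irreducible α ∧ 0 < e ∧ Associated p (α ^ e) := by
  have key : ∀ a b : F[X], a ∣ p → b ∣ p → IsCoprime a b → IsUnit a ∨ IsUnit b := by
    rintro a b ha hb ⟨s, t, hst⟩
    have unit_of : ∀ c d : F[X], c ∣ p →
        IsUnit (Ideal.Quotient.mk (Ideal.span {p}) (d * c)) → IsUnit c := by
      intro c d hc hu
      obtain ⟨v, hv⟩ := hu.exists_right_inv
      obtain ⟨v, rfl⟩ := Ideal.Quotient.mk_surjective v
      rw [← map_mul, ← map_one (Ideal.Quotient.mk _), Ideal.Quotient.eq,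
        Ideal.mem_span_singleton] at hv
      refine isUnit_of_dvd_one ((dvd_sub_right ?_).mp (hc.trans hv))
      exact ⟨d * v, by ring⟩
    refine (IsLocalRing.isUnit_or_isUnit_of_add_one
      (a := Ideal.Quotient.mk (Ideal.span {p}) (s * a))
      (b := Ideal.Quotient.mk (Ideal.span {p}) (t * b)) ?_).imp
      (unit_of _ _ ha) (unit_of _ _ hb)
    rw [← map_add, hst, map_one]
  have hp0 : p ≠ 0 := by
    rintro rfl
    rcases key X (X - 1) (dvd_zero _) (dvd_zero _) ⟨1, -1, by ring⟩ with h | h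
    · exact not_isUnit_X h
    · rw [← C_1] at h
      exact not_isUnit_X_sub_C _ h
  obtain ⟨α, hα, hdvd⟩ := WfDvdMonoid.exists_irreducible_factor hp hp0
  obtain ⟨e, q, hq, hpq⟩ := WfDvdMonoid.max_power_factor hp0 hα
  have he : e ≠ 0 := by
    rintro rfl
    exact hq (by simpa [hpq] using hdvd)
  have hcop : IsCoprime (α ^ e) q := ((Irreducible.coprime_iff_not_dvd hα).mpr hq).pow_left
  refine ⟨α, e, hα, Nat.pos_of_ne_zero he, ?_⟩
  rcases key _ _ ⟨q, hpq⟩ ⟨α ^ e, by rw [hpq, mul_comm]⟩ hcop with h | h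
  · exact absurd ((isUnit_pow_iff he).mp h) hα.not_isUnit
  · rw [hpq]
    exact associated_mul_unit_left _ _ h

/-- Proposition 6.4: `R[x]/I` is local iff the invariant sequence of `I` consists of the
powers `α^{e_0}, …, α^{e_{n-1}}` of a single irreducible `α` with
`e_0 ≥ ⋯ ≥ e_{n-1} ≥ 0` and `e_0 > 0`. -/
theorem quotient_local_iff_invariant_sequence_powers {R : Type*} [CommRing R] [IsLocalRing R]
    (π : R) (n : ℕ) (hn : 1 ≤ n)
    (hmax : IsLocalRing.maximalIdeal R = Ideal.span {π})
    (hnil : π ^ n = 0) (hne : π ^ (n - 1) ≠ 0)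
    (I : Ideal R[X]) (hI : I ≠ ⊤) (f : ℕ → R[X])
    (hcan : IsCanonicalSequence π n I f) :
    IsLocalRing (R[X] ⧸ I) ↔
      ∃ (α : (R ⧸ Ideal.span {π})[X]) (e : ℕ → ℕ),
        Irreducible α ∧ (∀ j : ℕ, j + 1 < n → e (j + 1) ≤ e j) ∧ 0 < e 0 ∧
          ∀ j < n, Associated (redMod π (f j)) (α ^ e j) := by
  have hM : (Ideal.span {π}).IsMaximal := hmax ▸ IsLocalRing.maximalIdeal.isMaximal R
  let : Field (R ⧸ Ideal.span {π}) := Ideal.Quotient.field _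
  have hf0 : f 0 ∈ I := by simpa using (hcan 0 hn).1
  have hdvd0 : ∀ g ∈ I, redMod π (f 0) ∣ redMod π g := fun g hg =>
    hcan.redMod_dvd hM hn (by simpa using hg)
  have hunit : ¬ IsUnit (redMod π (f 0)) := by
    intro hu
    obtain ⟨v, hv⟩ := hu.exists_right_inv
    obtain ⟨v, rfl⟩ := redMod_surjective π v
    have h := Ideal.isUnit_mk_of_redMod_eq_one hnil I (g := f 0 * v) (by rw [map_mul, hv])
    rw [Ideal.Quotient.eq_zero_iff_mem.mpr (I.mul_mem_right _ hf0)] at h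
    have := Ideal.Quotient.nontrivial_iff.mpr hI
    exact not_isUnit_zero h
  have hstep : ∀ j, j + 1 < n → redMod π (f (j + 1)) ∣ redMod π (f j) := fun j hj =>
    hcan.redMod_dvd hM hj (by
      rw [pow_succ', mul_assoc]
      exact I.mul_mem_left _ (hcan j (by lia)).1)
  constructor
  · intro hloc
    let φ : R[X] ⧸ I →+* (R ⧸ Ideal.span {π})[X] ⧸ Ideal.span {redMod π (f 0)} :=
      Ideal.Quotient.lift I ((Ideal.Quotient.mk _).comp (redMod π)) fun g hg =>
        Ideal.Quotient.eq_zero_iff_mem.mpr (Ideal.mem_span_singleton.mpr (hdvd0 g hg))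
    have hφ : Function.Surjective φ := Ideal.Quotient.lift_surjective_of_surjective _ _
      (Ideal.Quotient.mk_surjective.comp (redMod_surjective π))
    have := Ideal.Quotient.nontrivial_iff.mpr fun h =>
      hunit (Ideal.span_singleton_eq_top.mp h)
    have := IsLocalRing.of_surjective' φ hφ
    obtain ⟨α, d, hα, hd, hass⟩ := exists_associated_pow_of_isLocalRing_quotient hunit
    have hdvd : ∀ j < n, redMod π (f j) ∣ α ^ d := by
      intro j
      induction j with
      | zero => exact fun _ => hass.dvd
      | succ j ih => exact fun hj => (hstep j hj).trans (ih (by lia))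
    have hex : ∀ j, ∃ k, j < n → Associated (redMod π (f j)) (α ^ k) := by
      intro j
      by_cases hj : j < n
      · obtain ⟨k, -, hk⟩ := (dvd_prime_pow hα.prime d).mp (hdvd j hj)
        exact ⟨k, fun _ => hk⟩
      · exact ⟨0, fun h => absurd h hj⟩
    choose e he using hex
    refine ⟨α, e, hα, fun j hj => ?_, ?_, he⟩
    · refine (pow_dvd_pow_iff hα.ne_zero hα.not_isUnit).mp ?_
      exact (he _ hj).symm.dvd.trans ((hstep j hj).trans (he j (by lia)).dvd)
    · refine Nat.pos_of_ne_zero fun h0 => hunit ?_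
      have h := he 0 hn
      rw [h0, pow_zero] at h
      exact associated_one_iff_isUnit.mp h
  · rintro ⟨α, e, hα, -, he, hass⟩
    have hassoc := hass 0 hn
    have hα0 : α ∣ redMod π (f 0) := (dvd_pow_self α he.ne').trans hassoc.symm.dvd
    have hmaxα : (Ideal.span {α}).IsMaximal :=
      PrincipalIdealRing.isMaximal_of_irreducible hα
    let : Field ((R ⧸ Ideal.span {π})[X] ⧸ Ideal.span {α}) := Ideal.Quotient.field _
    let φ : R[X] ⧸ I →+* (R ⧸ Ideal.span {π})[X] ⧸ Ideal.span {α} :=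
      Ideal.Quotient.lift I ((Ideal.Quotient.mk _).comp (redMod π)) fun g hg =>
        Ideal.Quotient.eq_zero_iff_mem.mpr
          (Ideal.mem_span_singleton.mpr (hα0.trans (hdvd0 g hg)))
    have hφ : IsLocalHom φ := by
      refine ⟨fun a ha => ?_⟩
      obtain ⟨g, rfl⟩ := Ideal.Quotient.mk_surjective a
      have hndvd : ¬ α ∣ redMod π g := fun h =>
        ha.ne_zero (Ideal.Quotient.eq_zero_iff_mem.mpr (Ideal.mem_span_singleton.mpr h))
      have hcop : IsCoprime (α ^ e 0) (redMod π g) :=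
        ((Irreducible.coprime_iff_not_dvd hα).mpr hndvd).pow_left
      obtain ⟨s, t, hst⟩ := hcop.of_isCoprime_of_dvd_left hassoc.dvd
      obtain ⟨s, rfl⟩ := redMod_surjective π s
      obtain ⟨t, rfl⟩ := redMod_surjective π t
      have h := Ideal.isUnit_mk_of_redMod_eq_one hnil I (g := s * f 0 + t * g)
        (by rw [map_add, map_mul, map_mul, hst])
      rw [map_add, Ideal.Quotient.eq_zero_iff_mem.mpr (I.mul_mem_left s hf0), zero_add,
        map_mul] at h
      exact isUnit_of_mul_isUnit_right h
    exact RingHom.domain_isLocalRing φ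
end
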